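/- arXiv:1505.03728 — 2 statements merged into one kernel-verified Lean document; each statement's English description precedes it below -/
import Mathlib

section
/- For every real number φ, sinh(2φ)·φ − cosh(2φ) + 1 ≥ (2/3)·φ⁴. -/
lemma mul_sinh_sub_self_nonneg (x : ℝ) : 0 ≤ x * (Real.sinh x - x) := by
  rcases le_total 0 x with hx | hx
  · exact mul_nonneg hx (sub_nonneg.2 (Real.self_le_sinh_iff.2 hx))
  · exact mul_nonneg_of_nonpos_of_nonpos hx (sub_nonpos.2 (Real.sinh_le_self_iff.2 hx))

lemma monotone_mul_cosh_sub_sinh_sub_cube :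
    Monotone fun x : ℝ => 2 * x * Real.cosh (2 * x) - Real.sinh (2 * x) - 8 / 3 * x ^ 3 := by
  refine monotone_of_hasDerivAt_nonneg
    (f' := fun x => 2 * (2 * x * (Real.sinh (2 * x) - 2 * x))) (fun x => ?_)
    fun x => mul_nonneg zero_le_two (mul_sinh_sub_self_nonneg (2 * x))
  have h : HasDerivAt (fun y : ℝ => 2 * y) 2 x := by
    simpa using (hasDerivAt_id x).const_mul 2
  refine (((h.mul h.cosh).sub h.sinh).sub
    ((hasDerivAt_pow 3 x).const_mul (8 / 3))).congr_deriv ?_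
  push_cast
  ring

lemma mul_cosh_sub_sinh_sub_cube_nonneg {x : ℝ} (hx : 0 ≤ x) :
    0 ≤ 2 * x * Real.cosh (2 * x) - Real.sinh (2 * x) - 8 / 3 * x ^ 3 := by
  simpa using monotone_mul_cosh_sub_sinh_sub_cube hx

lemma mul_sinh_sub_cosh_ge_of_nonneg {x : ℝ} (hx : 0 ≤ x) :
    2 / 3 * x ^ 4 ≤ Real.sinh (2 * x) * x - Real.cosh (2 * x) + 1 := by
  have hd (y : ℝ) :
      HasDerivAt (fun y : ℝ => Real.sinh (2 * y) * y - Real.cosh (2 * y) - 2 / 3 * y ^ 4)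
        (2 * y * Real.cosh (2 * y) - Real.sinh (2 * y) - 8 / 3 * y ^ 3) y := by
    have h : HasDerivAt (fun y : ℝ => 2 * y) 2 y := by
      simpa using (hasDerivAt_id y).const_mul 2
    refine (((h.sinh.mul (hasDerivAt_id y)).sub h.cosh).sub
      ((hasDerivAt_pow 4 y).const_mul (2 / 3))).congr_deriv ?_
    push_cast
    simp only [id]
    ring
  have hmono : MonotoneOn
      (fun y : ℝ => Real.sinh (2 * y) * y - Real.cosh (2 * y) - 2 / 3 * y ^ 4) (Set.Ici 0) :=
    monotoneOn_of_hasDerivWithinAt_nonneg (convex_Ici 0)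
      (fun y _ => (hd y).continuousAt.continuousWithinAt)
      (fun y _ => (hd y).hasDerivWithinAt)
      fun y hy => mul_cosh_sub_sinh_sub_cube_nonneg (interior_subset hy)
  have h := hmono Set.self_mem_Ici hx hx
  norm_num at h
  linarith

theorem sinh_mul_sub_cosh_ge (φ : ℝ) :
    Real.sinh (2 * φ) * φ - Real.cosh (2 * φ) + 1 ≥ (2 / 3) * φ ^ 4 := by
  rcases le_total 0 φ with h | h
  · exact mul_sinh_sub_cosh_ge_of_nonneg h
  · simpa [Even.neg_pow (by decide : Even 4)] using
      mul_sinh_sub_cosh_ge_of_nonneg (neg_nonneg.2 h)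
end

section
/- Let A ≥ 3/4 and φ ≥ 0 be real numbers. Then sinh(2φ)·φ − (cosh(2φ) − 1)·φ − (cosh(2φ) − 1) + (sinh(2φ) − 2φ) + A·( (cosh(2φ) − 1) − (sinh(2φ) − 2φ) ) ≥ 0. -/
theorem bracket_inequality (A φ : ℝ) (hA : 3 / 4 ≤ A) (hφ : 0 ≤ φ) :
    Real.sinh (2 * φ) * φ - (Real.cosh (2 * φ) - 1) * φ - (Real.cosh (2 * φ) - 1)
        + (Real.sinh (2 * φ) - 2 * φ)
        + A * ((Real.cosh (2 * φ) - 1) - (Real.sinh (2 * φ) - 2 * φ)) ≥ 0 := by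
  have hcosh : Real.cosh (2 * φ) = Real.sinh (2 * φ) + Real.exp (-(2 * φ)) := by
    linarith [Real.cosh_sub_sinh (2 * φ)]
  have hexp : (4 * φ + 1) * Real.exp (-(2 * φ)) ≤ 2 * φ + 1 := by
    rw [Real.exp_neg, ← div_eq_mul_inv, div_le_iff₀ (Real.exp_pos _)]
    nlinarith [Real.add_one_le_exp (2 * φ)]
  have hrem : 0 ≤ Real.exp (-(2 * φ)) - 1 + 2 * φ := by
    linarith [Real.add_one_le_exp (-(2 * φ))]
  rw [hcosh]
  linarith [mul_nonneg (sub_nonneg.2 hA) hrem]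
end
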